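/- The map q ↦ Q_q is a bijection from 𝒬_e^{(i)} onto 𝒬_b, and it is affine over A_i: for every q ∈ 𝒬_e^{(i)} and every α ∈ A_i one has Q_{α+q} = α + Q_q, where (α+q)(x) := q(x) + 2e(α, x) for x ∈ A₂ and (α+Q)(y) := Q(y) + 2b(α, y) for y ∈ A_i. -/

import Mathlib

/-- The embedding `F₂ ≅ 2ℤ/4ℤ ⊂ ℤ/4ℤ`. -/
def emb2 (t : ZMod 2) : ZMod 4 := 2 * t.val

/-- The set of quadratic forms (with values in `ℤ/4ℤ`) associated to a symmetric
`F₂`-bilinear form `β`. -/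
def QuadSet {V : Type*} [Add V] (β : V → V → ZMod 2) : Set (V → ZMod 4) :=
  {q | ∀ x y, q (x + y) = q x + q y + emb2 (β x y)}

/-- `ε := id + ī`, an `F₂`-linear endomorphism of `A₂`. -/
def eps {A : Type*} [AddCommGroup A] [Module (ZMod 2) A]
    (Ibar : A →ₗ[ZMod 2] A) : A →ₗ[ZMod 2] A :=
  LinearMap.id + Ibar

/-- `A_i := ε(A₂)`. -/
def Asub {A : Type*} [AddCommGroup A] [Module (ZMod 2) A]
    (Ibar : A →ₗ[ZMod 2] A) : Submodule (ZMod 2) A :=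
  LinearMap.range (eps Ibar)

/-- `εα`, as an element of `A_i`. -/
def epsEl {A : Type*} [AddCommGroup A] [Module (ZMod 2) A]
    (Ibar : A →ₗ[ZMod 2] A) (α : A) : ↥(Asub Ibar) :=
  ⟨eps Ibar α, LinearMap.mem_range_self _ α⟩

theorem emb2_add' : ∀ s t : ZMod 2, emb2 (s + t) = emb2 s + emb2 t := by decide

theorem emb2_dbl' : ∀ s : ZMod 2, emb2 s + emb2 s = 0 := by decide

theorem emb2_cast' (n : ℤ) : emb2 (n : ZMod 2) = 2 * (n : ZMod 4) := by
  have h1 : ∀ c : ZMod 4, emb2 (ZMod.castHom (show 2 ∣ 4 by norm_num) (ZMod 2) c) = 2 * c := by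
    decide
  have h2 := h1 (n : ZMod 4)
  rwa [map_intCast] at h2

/-- The map `q ↦ Q_q` is a bijection from `𝒬_e^{(i)}` onto `𝒬_b`, and it is
affine over `A_i`: for every `q ∈ 𝒬_e^{(i)}` and every `α ∈ A_i` one has `Q_{α+q} = α + Q_q`,
where `(α+q)(x) := q(x) + 2e(α, x)` and `(α+Q)(y) := Q(y) + 2b(α, y)`. -/
theorem statement7 (g : ℕ) (hg : 1 ≤ g)
    (Γ : Type) [AddCommGroup Γ] [Module ℤ Γ]
    [Module.Free ℤ Γ] [Module.Finite ℤ Γ]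
    (hrank : Module.finrank ℤ Γ = 2 * g)
    (S : Γ →ₗ[ℤ] Γ →ₗ[ℤ] ℤ)
    (hSsymm : ∀ x y : Γ, S x y = S y x)
    (hSpos : ∀ x : Γ, x ≠ 0 → 0 < S x x)
    (I : Γ ≃ₗ[ℤ] Γ)
    (hI2 : ∀ x : Γ, I (I x) = -x)
    (hSI : ∀ x y : Γ, S (I x) (I y) = S x y)
    (hunimod : Function.Bijective fun x : Γ => S x)
    (A₂ : Type) [AddCommGroup A₂] [Module (ZMod 2) A₂]
    (pr : Γ →+ A₂) (hpr : Function.Surjective pr)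
    (hker : ∀ x : Γ, pr x = 0 ↔ ∃ y : Γ, x = 2 • y)
    (Ibar : A₂ →ₗ[ZMod 2] A₂) (hIbar : ∀ x : Γ, Ibar (pr x) = pr (I x))
    (e : A₂ →ₗ[ZMod 2] A₂ →ₗ[ZMod 2] ZMod 2)
    (he : ∀ x y : Γ, e (pr x) (pr y) = ((S (I x) y : ℤ) : ZMod 2))
    (Q : A₂ → ZMod 4)
    (hQ : ∀ x : Γ, Q (pr x) = ((S x x : ℤ) : ZMod 4))
    (b : ↥(Asub Ibar) →ₗ[ZMod 2] ↥(Asub Ibar) →ₗ[ZMod 2] ZMod 2)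
    (hb : ∀ α β : A₂, b (epsEl Ibar α) (epsEl Ibar β) = e α (eps Ibar β))
    -- the map `q ↦ Q_q`, where `Q_q` is determined by `Q_q(εα) = q(α) − Q(α)`
    (Qmap : (A₂ → ZMod 4) → (↥(Asub Ibar) → ZMod 4))
    (hQmap : ∀ q ∈ QuadSet (fun x y => e x y) ∩ {q | ∀ x, q (Ibar x) = q x},
      ∀ α : A₂, Qmap q (epsEl Ibar α) = q α - Q α) :
    Set.BijOn Qmap (QuadSet (fun x y => e x y) ∩ {q | ∀ x, q (Ibar x) = q x})
      (QuadSet (fun x y => b x y)) ∧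
    (∀ q ∈ QuadSet (fun x y => e x y) ∩ {q | ∀ x, q (Ibar x) = q x},
      ∀ α : A₂, ∀ hα : α ∈ Asub Ibar, ∀ y : ↥(Asub Ibar),
        Qmap (fun x => q x + emb2 (e α x)) y = Qmap q y + emb2 (b ⟨α, hα⟩ y)) := by
  have neg2 : ∀ x : A₂, -x = x := fun x => by
    have h : (2 : ZMod 2) • x = 0 := by
      rw [show (2 : ZMod 2) = 0 from rfl, zero_smul]
    rw [two_smul] at h
    exact neg_eq_of_add_eq_zero_left h
  have F1 : ∀ x, Ibar (Ibar x) = x := by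
    intro x
    obtain ⟨x, rfl⟩ := hpr x
    rw [hIbar, hIbar, hI2, map_neg, neg2]
  have F2' : ∀ x y : Γ, e (pr x) (Ibar (pr y)) = ((S x y : ℤ) : ZMod 2) := by
    intro x y
    rw [hIbar, he, hSI]
  have F2 : ∀ x y, e (Ibar x) y = e x (Ibar y) := by
    intro x y
    obtain ⟨x, rfl⟩ := hpr x
    obtain ⟨y, rfl⟩ := hpr y
    rw [F2', hIbar, he, hI2, map_neg, LinearMap.neg_apply, Int.cast_neg]
    exact ZMod.neg_eq_self_mod_two _
  have F3 : ∀ x y, Q (x + y) = Q x + Q y + emb2 (e x (Ibar y)) := by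
    intro x y
    obtain ⟨x, rfl⟩ := hpr x
    obtain ⟨y, rfl⟩ := hpr y
    rw [F2', emb2_cast', ← map_add, hQ, hQ, hQ]
    simp only [map_add, LinearMap.add_apply, hSsymm y x]
    push_cast
    ring
  have F4 : ∀ x, Q (Ibar x) = Q x := by
    intro x
    obtain ⟨x, rfl⟩ := hpr x
    rw [hIbar, hQ, hQ, hSI]
  have epsd : ∀ x, eps Ibar x = x + Ibar x := fun x => rfl
  have epsadd : ∀ x y, epsEl Ibar (x + y) = epsEl Ibar x + epsEl Ibar y := fun x y =>
    Subtype.ext (map_add (eps Ibar) x y)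
  have epsI : ∀ x, epsEl Ibar (Ibar x) = epsEl Ibar x := fun x =>
    Subtype.ext (by
      change eps Ibar (Ibar x) = eps Ibar x
      rw [epsd, epsd, F1, add_comm])
  have epssurj : ∀ y : ↥(Asub Ibar), ∃ x, epsEl Ibar x = y := by
    rintro ⟨_, x, rfl⟩
    exact ⟨x, rfl⟩
  have hb' : ∀ x y, emb2 (b (epsEl Ibar x) (epsEl Ibar y))
      = emb2 (e x y) + emb2 (e x (Ibar y)) := by
    intro x y
    rw [hb, epsd, map_add, emb2_add']
  refine ⟨⟨?_, ?_, ?_⟩, ?_⟩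
  · intro q hq y z
    obtain ⟨x, rfl⟩ := epssurj y
    obtain ⟨w, rfl⟩ := epssurj z
    have hqq := hq.1 x w
    simp only at hqq ⊢
    rw [← epsadd, hQmap q hq, hQmap q hq, hQmap q hq, hb', F3, hqq]
    linear_combination -(emb2_dbl' (e x (Ibar w)))
  · intro q hq r hr h
    funext x
    have h1 := congrFun h (epsEl Ibar x)
    rw [hQmap q hq, hQmap r hr] at h1
    exact sub_left_injective h1
  · intro P hP
    have hm : (fun x => P (epsEl Ibar x) + Q x) ∈
        QuadSet (fun x y => e x y) ∩ {q | ∀ x, q (Ibar x) = q x} := by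
      refine ⟨?_, ?_⟩
      · intro x y
        have h := hP (epsEl Ibar x) (epsEl Ibar y)
        simp only at h ⊢
        rw [epsadd, h, hb', F3]
        linear_combination (emb2_dbl' (e x (Ibar y)))
      · intro x
        simp only
        rw [epsI, F4]
    refine ⟨_, hm, ?_⟩
    funext y
    obtain ⟨x, rfl⟩ := epssurj y
    rw [hQmap _ hm]
    ring
  · rintro q hq _ ⟨a, rfl⟩ y
    obtain ⟨x, rfl⟩ := epssurj y
    have hinv : ∀ x, e (eps Ibar a) x = e a x + e a (Ibar x) := by
      intro x
      rw [epsd, map_add, LinearMap.add_apply, F2]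
    have hm : (fun x => q x + emb2 (e (eps Ibar a) x)) ∈
        QuadSet (fun x y => e x y) ∩ {q | ∀ x, q (Ibar x) = q x} := by
      refine ⟨?_, ?_⟩
      · intro x y
        have h := hq.1 x y
        simp only at h ⊢
        rw [h, map_add, emb2_add']
        ring
      · intro x
        have h := hq.2 x
        simp only
        rw [h, hinv, hinv, F1, add_comm (e a x)]
    rw [hQmap _ hm, hQmap _ hq]
    change _ = _ + emb2 (b (epsEl Ibar a) (epsEl Ibar x))
    rw [hb', hinv, emb2_add']
    ring
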